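/- arXiv:2512.12335 — 2 statements merged into one kernel-verified Lean document; each statement's English description precedes it below -/
import Mathlib

section
/- If C is a free E-linear code of length n, then the rank of Hull(C), defined as the minimum cardinality of a generating set of Hull(C), equals the F₂-dimension of Hull(C_Res) = C_Res ∩ (C_Res)^⊥. -/
open scoped BigOperators

/-- The non-unital ring `E` of order 4: the pair `(u, v)` represents `uκ + vζ`,
where `ζ = κ + τ`.  Multiplication: `(uκ + vζ)·(u'κ + v'ζ) = u'·(uκ + vζ)`. -/
def RingE : Type := ZMod 2 × ZMod 2

namespace RingE

instance : AddCommGroup RingE := inferInstanceAs (AddCommGroup (ZMod 2 × ZMod 2))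

instance : Mul RingE := ⟨fun a b => Prod.mk (Prod.fst a * Prod.fst b) (Prod.snd a * Prod.fst b)⟩

noncomputable instance : DecidableEq RingE := Classical.decEq _

instance : NonUnitalRing RingE where
  left_distrib a b c := by
    show Prod.mk (Prod.fst a * (Prod.fst b + Prod.fst c))
        (Prod.snd a * (Prod.fst b + Prod.fst c)) = _
    show _ = Prod.mk (Prod.fst a * Prod.fst b + Prod.fst a * Prod.fst c)
        (Prod.snd a * Prod.fst b + Prod.snd a * Prod.fst c)
    simp [mul_add]
  right_distrib a b c := by
    show Prod.mk ((Prod.fst a + Prod.fst b) * Prod.fst c)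
        ((Prod.snd a + Prod.snd b) * Prod.fst c) = _
    show _ = Prod.mk (Prod.fst a * Prod.fst c + Prod.fst b * Prod.fst c)
        (Prod.snd a * Prod.fst c + Prod.snd b * Prod.fst c)
    simp [add_mul]
  zero_mul a := by
    show Prod.mk ((0 : ZMod 2) * Prod.fst a) ((0 : ZMod 2) * Prod.fst a) = ((0 : ZMod 2), (0 : ZMod 2))
    simp
  mul_zero a := by
    show Prod.mk (Prod.fst a * (0 : ZMod 2)) (Prod.snd a * (0 : ZMod 2)) = ((0 : ZMod 2), (0 : ZMod 2))
    simp
  mul_assoc a b c := by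
    show Prod.mk (Prod.fst a * Prod.fst b * Prod.fst c) (Prod.snd a * Prod.fst b * Prod.fst c)
      = Prod.mk (Prod.fst a * (Prod.fst b * Prod.fst c)) (Prod.snd a * (Prod.fst b * Prod.fst c))
    simp [mul_assoc]

/-- The generator `κ`. -/
def kappa : RingE := Prod.mk 1 0

/-- The generator `τ`. -/
def tau : RingE := Prod.mk 1 1

/-- `ζ = κ + τ`. -/
def zeta : RingE := Prod.mk 0 1

/-- The reduction map `π : E → F₂`, sending `uκ + vζ` to `u`. -/
def pi (a : RingE) : ZMod 2 := Prod.fst a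

/-- `κ·c` for a scalar `c ∈ F₂`, i.e. the element `cκ` of `E`. -/
def kappaSMul (c : ZMod 2) : RingE := Prod.mk c 0

/-- `ζ·c` for a scalar `c ∈ F₂`, i.e. the element `cζ` of `E`. -/
def zetaSMul (c : ZMod 2) : RingE := Prod.mk 0 c

end RingE

namespace ECode

/-- Componentwise reduction `π : Eⁿ → F₂ⁿ`. -/
def piVec {n : ℕ} (x : Fin n → RingE) : Fin n → ZMod 2 := fun i => RingE.pi (x i)

/-- The vector `κv ∈ Eⁿ` attached to `v ∈ F₂ⁿ`. -/
def kappaVec {n : ℕ} (v : Fin n → ZMod 2) : Fin n → RingE := fun i => RingE.kappaSMul (v i)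

/-- The vector `ζv ∈ Eⁿ` attached to `v ∈ F₂ⁿ`. -/
def zetaVec {n : ℕ} (v : Fin n → ZMod 2) : Fin n → RingE := fun i => RingE.zetaSMul (v i)

/-- An `E`-linear code of length `n`: a left `E`-submodule of `Eⁿ`, i.e. an additive
subgroup closed under componentwise left multiplication by elements of `E`. -/
def IsECode {n : ℕ} (C : Set (Fin n → RingE)) : Prop :=
  (0 : Fin n → RingE) ∈ C ∧ (∀ x ∈ C, ∀ y ∈ C, x + y ∈ C) ∧ (∀ x ∈ C, -x ∈ C) ∧
    ∀ (a : RingE), ∀ x ∈ C, (fun i => a * x i) ∈ C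

/-- The residue code `C_Res = π(C)`. -/
def Res {n : ℕ} (C : Set (Fin n → RingE)) : Set (Fin n → ZMod 2) := piVec '' C

/-- The torsion code `C_Tor = {v ∈ F₂ⁿ : ζv ∈ C}`. -/
def Tor {n : ℕ} (C : Set (Fin n → RingE)) : Set (Fin n → ZMod 2) := {v | zetaVec v ∈ C}

/-- A code is free if its residue and torsion codes coincide. -/
def IsFree {n : ℕ} (C : Set (Fin n → RingE)) : Prop := Res C = Tor C

/-- The inner product on `Eⁿ`. -/
def Einner {n : ℕ} (w z : Fin n → RingE) : RingE := ∑ i, w i * z i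

/-- The left dual `C^{⊥L}`. -/
def dualL {n : ℕ} (C : Set (Fin n → RingE)) : Set (Fin n → RingE) :=
  {z | ∀ w ∈ C, Einner z w = 0}

/-- The right dual `C^{⊥R}`. -/
def dualR {n : ℕ} (C : Set (Fin n → RingE)) : Set (Fin n → RingE) :=
  {z | ∀ w ∈ C, Einner w z = 0}

/-- The (two-sided) dual `C^⊥ = C^{⊥L} ∩ C^{⊥R}`. -/
def dualE {n : ℕ} (C : Set (Fin n → RingE)) : Set (Fin n → RingE) := dualL C ∩ dualR C

/-- The left hull `LHull(C) = C ∩ C^{⊥L}`. -/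
def LHull {n : ℕ} (C : Set (Fin n → RingE)) : Set (Fin n → RingE) := C ∩ dualL C

/-- The right hull `RHull(C) = C ∩ C^{⊥R}`. -/
def RHull {n : ℕ} (C : Set (Fin n → RingE)) : Set (Fin n → RingE) := C ∩ dualR C

/-- The hull `Hull(C) = C ∩ C^⊥`. -/
def EHull {n : ℕ} (C : Set (Fin n → RingE)) : Set (Fin n → RingE) := C ∩ dualE C

/-- The Euclidean inner product on `F₂ⁿ`. -/
def Finner {n : ℕ} (w z : Fin n → ZMod 2) : ZMod 2 := ∑ i, w i * z i

/-- The Euclidean dual of an `F₂`-linear code. -/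
def dualF {n : ℕ} (B : Set (Fin n → ZMod 2)) : Set (Fin n → ZMod 2) :=
  {z | ∀ w ∈ B, Finner w z = 0}

/-- The hull of an `F₂`-linear code. -/
def FHull {n : ℕ} (B : Set (Fin n → ZMod 2)) : Set (Fin n → ZMod 2) := B ∩ dualF B

/-- `F₂`-dimension of an `F₂`-linear code (as the dimension of its span). -/
noncomputable def dimF {n : ℕ} (B : Set (Fin n → ZMod 2)) : ℕ :=
  Module.finrank (ZMod 2) (Submodule.span (ZMod 2) B)

/-- Scalar multiplication of a vector of `Eⁿ` by `a ∈ E`. -/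
def smulVec {n : ℕ} (a : RingE) (x : Fin n → RingE) : Fin n → RingE := fun i => a * x i

/-- The left `E`-span `⟨X⟩_E` of a finite set `X ⊆ Eⁿ`. -/
def spanE {n : ℕ} (X : Finset (Fin n → RingE)) : Set (Fin n → RingE) :=
  {y | ∃ c : (Fin n → RingE) → RingE, y = ∑ x ∈ X, smulVec (c x) x}

/-- The additive (`F₂`-) span `⟨X⟩_{F₂}` of a finite set `X ⊆ Eⁿ`: all sums of subsets. -/
def spanF {n : ℕ} (X : Finset (Fin n → RingE)) : Set (Fin n → RingE) :=
  {y | ∃ S : Finset (Fin n → RingE), S ⊆ X ∧ y = ∑ x ∈ S, x}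

/-- `X` is a generating set of the code `D` if `⟨X⟩_E ∪ ⟨X⟩_{F₂} = D`. -/
def IsGenSet {n : ℕ} (X : Finset (Fin n → RingE)) (D : Set (Fin n → RingE)) : Prop :=
  spanE X ∪ spanF X = D

/-- The rank of a (free) code: the minimum cardinality of a generating set. -/
noncomputable def genRank {n : ℕ} (D : Set (Fin n → RingE)) : ℕ :=
  sInf {m | ∃ X : Finset (Fin n → RingE), X.card = m ∧ IsGenSet X D}

/-- Prepending two coordinates to a vector of length `n`. -/
def cons2 {n : ℕ} (a b : RingE) (x : Fin n → RingE) : Fin (n + 2) → RingE :=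
  Fin.cons a (Fin.cons b x)

end ECode

namespace ECode

/-- The `ζ`-part of a vector. -/
def sndVec {n : ℕ} (x : Fin n → RingE) : Fin n → ZMod 2 := fun i => Prod.snd (x i)

def piHom (n : ℕ) : (Fin n → RingE) →+ (Fin n → ZMod 2) where
  toFun := piVec
  map_zero' := rfl
  map_add' _ _ := rfl

def sndHom (n : ℕ) : (Fin n → RingE) →+ (Fin n → ZMod 2) where
  toFun := sndVec
  map_zero' := rfl
  map_add' _ _ := rfl

def fstE : RingE →+ ZMod 2 where
  toFun := RingE.pi
  map_zero' := rfl
  map_add' _ _ := rfl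

def sndE : RingE →+ ZMod 2 where
  toFun x := Prod.snd x
  map_zero' := rfl
  map_add' _ _ := rfl

theorem ext_vec {n : ℕ} {x y : Fin n → RingE} (h1 : piVec x = piVec y)
    (h2 : sndVec x = sndVec y) : x = y := by
  funext i
  exact Prod.ext (congrFun h1 i) (congrFun h2 i)

theorem fst_inner {n : ℕ} (w z : Fin n → RingE) :
    fstE (Einner w z) = Finner (piVec w) (piVec z) := by
  unfold Einner Finner
  rw [map_sum]
  rfl

theorem snd_inner {n : ℕ} (w z : Fin n → RingE) :
    sndE (Einner w z) = Finner (sndVec w) (piVec z) := by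
  unfold Einner Finner
  rw [map_sum]
  rfl

theorem inner_zero_iff {n : ℕ} (w z : Fin n → RingE) :
    Einner w z = 0 ↔ Finner (piVec w) (piVec z) = 0 ∧ Finner (sndVec w) (piVec z) = 0 := by
  rw [← fst_inner, ← snd_inner]
  constructor
  · intro h
    rw [h]
    simp
  · rintro ⟨h1, h2⟩
    exact Prod.ext h1 h2

theorem Finner_comm {n : ℕ} (w z : Fin n → ZMod 2) : Finner w z = Finner z w := by
  unfold Finner
  simp [mul_comm]

theorem kappaVec_mem {n : ℕ} {C : Set (Fin n → RingE)} (hC : IsECode C) {v : Fin n → ZMod 2}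
    (hv : v ∈ Res C) : kappaVec v ∈ C := by
  obtain ⟨x, hx, rfl⟩ := hv
  have h := hC.2.2.2 RingE.kappa x hx
  convert h using 1
  refine ext_vec ?_ ?_
  · funext i
    change RingE.pi (x i) = 1 * RingE.pi (x i)
    simp
  · funext i
    change 0 = 0 * RingE.pi (x i)
    simp

theorem mem_iff {n : ℕ} {C : Set (Fin n → RingE)} (hC : IsECode C) (hf : IsFree C)
    (y : Fin n → RingE) : y ∈ C ↔ piVec y ∈ Res C ∧ sndVec y ∈ Res C := by
  have key : y = kappaVec (piVec y) + zetaVec (sndVec y) := by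
    refine ext_vec ?_ ?_
    · funext i
      change RingE.pi (y i) = RingE.pi (y i) + 0
      simp
    · funext i
      change Prod.snd (y i) = 0 + Prod.snd (y i)
      simp
  constructor
  · intro hy
    have h1 : piVec y ∈ Res C := ⟨y, hy, rfl⟩
    refine ⟨h1, ?_⟩
    rw [hf]
    change zetaVec (sndVec y) ∈ C
    have h3 : zetaVec (sndVec y) = y + -(kappaVec (piVec y)) := by
      rw [← sub_eq_add_neg, eq_sub_iff_add_eq, add_comm]
      exact key.symm
    rw [h3]
    exact hC.2.1 _ hy _ (hC.2.2.1 _ (kappaVec_mem hC h1))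
  · rintro ⟨h1, h2⟩
    rw [key]
    rw [hf] at h2
    exact hC.2.1 _ (kappaVec_mem hC h1) _ h2

theorem hull_iff {n : ℕ} {C : Set (Fin n → RingE)} (hC : IsECode C) (hf : IsFree C)
    (y : Fin n → RingE) : y ∈ EHull C ↔ piVec y ∈ Res C ∩ dualF (Res C) ∧
      sndVec y ∈ Res C ∩ dualF (Res C) := by
  constructor
  · rintro ⟨h, hl, _⟩
    obtain ⟨h1, h2⟩ := (mem_iff hC hf y).1 h
    refine ⟨⟨h1, ?_⟩, ⟨h2, ?_⟩⟩
    · rintro _ ⟨w, hw, rfl⟩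
      rw [Finner_comm]
      exact ((inner_zero_iff _ _).1 (hl w hw)).1
    · rintro _ ⟨w, hw, rfl⟩
      rw [Finner_comm]
      exact ((inner_zero_iff _ _).1 (hl w hw)).2
  · rintro ⟨⟨h1, h3⟩, ⟨h2, h4⟩⟩
    refine ⟨(mem_iff hC hf y).2 ⟨h1, h2⟩, ?_, ?_⟩
    · intro w hw
      have hw' := (mem_iff hC hf w).1 hw
      rw [inner_zero_iff, Finner_comm, Finner_comm (sndVec y)]
      exact ⟨h3 _ hw'.1, h4 _ hw'.1⟩
    · intro w hw
      have hw' := (mem_iff hC hf w).1 hw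
      rw [inner_zero_iff]
      exact ⟨h3 _ hw'.1, h3 _ hw'.2⟩

/-- The hull of the residue code as a submodule. -/
def hullSub {n : ℕ} {C : Set (Fin n → RingE)} (hC : IsECode C) :
    Submodule (ZMod 2) (Fin n → ZMod 2) where
  carrier := Res C ∩ dualF (Res C)
  zero_mem' := ⟨⟨0, hC.1, rfl⟩, fun w _ => by simp [Finner]⟩
  add_mem' := by
    rintro a b ⟨⟨x, hx, rfl⟩, ha⟩ ⟨⟨y, hy, rfl⟩, hb⟩
    refine ⟨⟨x + y, hC.2.1 _ hx _ hy, rfl⟩, fun w hw => ?_⟩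
    have h1 := ha w hw
    have h2 := hb w hw
    unfold Finner at *
    simp [mul_add, Finset.sum_add_distrib, h1, h2]
  smul_mem' := by
    intro c x hx
    have hc : c = 0 ∨ c = 1 := by
      revert c
      decide
    rcases hc with rfl | rfl
    · rw [zero_smul]
      exact ⟨⟨0, hC.1, rfl⟩, fun w _ => by simp [Finner]⟩
    · rwa [one_smul]

theorem piVec_smul {n : ℕ} (a : RingE) (x : Fin n → RingE) :
    piVec (smulVec a x) = fstE a • piVec x := rfl

theorem sndVec_smul {n : ℕ} (a : RingE) (x : Fin n → RingE) :
    sndVec (smulVec a x) = sndE a • piVec x := rfl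

theorem piVec_sum {n : ℕ} {ι : Type} (s : Finset ι) (f : ι → Fin n → RingE) :
    piVec (∑ x ∈ s, f x) = ∑ x ∈ s, piVec (f x) := map_sum (piHom n) f s

theorem sndVec_sum {n : ℕ} {ι : Type} (s : Finset ι) (f : ι → Fin n → RingE) :
    sndVec (∑ x ∈ s, f x) = ∑ x ∈ s, sndVec (f x) := map_sum (sndHom n) f s

end ECode

open ECode in
/-- If `C` is free, the rank of `Hull(C)` (minimum cardinality of a
generating set) equals `dim_{F₂} Hull(C_Res) = dim_{F₂}(C_Res ∩ (C_Res)^⊥)`. -/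
theorem hull_rank_eq {n : ℕ} (C : Set (Fin n → RingE)) (hC : IsECode C)
    (hfree : IsFree C) :
    genRank (EHull C) = dimF (Res C ∩ dualF (Res C)) := by
  classical
  have hspan : Submodule.span (ZMod 2) (Res C ∩ dualF (Res C)) = hullSub hC :=
    Submodule.span_eq (hullSub hC)
  unfold dimF
  rw [hspan]
  have hmem : ∀ v, v ∈ hullSub hC ↔ v ∈ Res C ∩ dualF (Res C) := fun _ => Iff.rfl
  have hull := hull_iff hC hfree
  simp only [← hmem] at hull
  have hex : ∃ X : Finset (Fin n → RingE),
      X.card ≤ Module.finrank (ZMod 2) (hullSub hC) ∧ IsGenSet X (EHull C) := by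
    obtain ⟨b, hb, hbc, hbs, -⟩ := Submodule.exists_finset_span_eq_linearIndepOn (ZMod 2)
      ((hullSub hC : Submodule (ZMod 2) (Fin n → ZMod 2)) : Set (Fin n → ZMod 2))
    rw [Submodule.span_eq] at hbc hbs
    have hinj : Set.InjOn (kappaVec (n := n)) b := fun x _ y _ h => congrArg piVec h
    have hb' : ∀ v ∈ b, v ∈ hullSub hC := fun v hv => hb hv
    have hX : ∀ x ∈ b.image kappaVec, piVec x ∈ hullSub hC ∧ sndVec x ∈ hullSub hC := by
      intro x hx
      obtain ⟨v, hv, rfl⟩ := Finset.mem_image.1 hx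
      exact ⟨hb' v hv, (hullSub hC).zero_mem⟩
    refine ⟨b.image kappaVec, Finset.card_image_le.trans hbc.le, ?_⟩
    refine Set.Subset.antisymm ?_ ?_
    · rintro y (⟨c, rfl⟩ | ⟨S, hS, rfl⟩)
      · rw [hull, piVec_sum, sndVec_sum]
        exact ⟨Submodule.sum_mem _ fun x hx => Submodule.smul_mem _ _ (hX x hx).1,
          Submodule.sum_mem _ fun x hx => Submodule.smul_mem _ _ (hX x hx).1⟩
      · rw [hull, piVec_sum, sndVec_sum]
        exact ⟨Submodule.sum_mem _ fun x hx => (hX x (hS hx)).1,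
          Submodule.sum_mem _ fun x hx => (hX x (hS hx)).2⟩
    · intro y hy
      left
      rw [hull, ← hbs, Submodule.mem_span_finset, Submodule.mem_span_finset] at hy
      obtain ⟨⟨f, -, hf⟩, ⟨g, -, hg⟩⟩ := hy
      refine ⟨fun x => (Prod.mk (f (piVec x)) (g (piVec x)) : ZMod 2 × ZMod 2), ?_⟩
      rw [Finset.sum_image hinj]
      refine ext_vec ?_ ?_
      · rw [piVec_sum, ← hf]
        rfl
      · rw [sndVec_sum, ← hg]
        rfl
  have hlow : ∀ X : Finset (Fin n → RingE), IsGenSet X (EHull C) →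
      Module.finrank (ZMod 2) (hullSub hC) ≤ X.card := by
    intro X hX
    have hle : hullSub hC ≤ Submodule.span (ZMod 2) ((X.image piVec : Finset _) : Set (Fin n → ZMod 2)) := by
      intro v hv
      have h1 : kappaVec v ∈ EHull C := (hull _).2 ⟨hv, (hullSub hC).zero_mem⟩
      rw [← hX] at h1
      change piVec (kappaVec v) ∈ _
      have hs : ∀ x ∈ X, piVec x ∈ Submodule.span (ZMod 2)
          ((X.image piVec : Finset _) : Set (Fin n → ZMod 2)) := fun x hx =>
        Submodule.subset_span (Finset.mem_coe.2 (Finset.mem_image_of_mem _ hx))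
      rcases h1 with ⟨c, hc⟩ | ⟨S, hS, hc⟩
      · rw [hc, piVec_sum]
        refine Submodule.sum_mem _ fun x hx => ?_
        rw [piVec_smul]
        exact Submodule.smul_mem _ _ (hs x hx)
      · rw [hc, piVec_sum]
        exact Submodule.sum_mem _ fun x hx => hs x (hS hx)
    exact (Submodule.finrank_mono hle).trans
      ((finrank_span_finset_le_card _).trans Finset.card_image_le)
  obtain ⟨X, hXc, hX⟩ := hex
  have hXm : X.card ∈ {m | ∃ X : Finset (Fin n → RingE), X.card = m ∧ IsGenSet X (EHull C)} :=
    ⟨X, rfl, hX⟩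
  refine le_antisymm ((Nat.sInf_le hXm).trans hXc) ?_
  refine le_csInf ⟨_, hXm⟩ ?_
  rintro _ ⟨Y, rfl, hY⟩
  exact hlow Y hY
end

section
/- (Build-up Construction II.) Let C be a free E-linear code of length n with dim_{F₂}(C_Res) = k and hull-rank l, let r₁, …, r_k ∈ F₂ⁿ be a basis of C_Res, and let u ∈ F₂ⁿ satisfy ⟨u, u⟩ = 0 and ⟨u, rᵢ⟩ = 0 for all 1 ≤ i ≤ k. Let D be the E-linear code of length n + 2 generated by the k + 1 vectors (κ, κ, κu₁, …, κu_n) and (0, 0, κr_{i,1}, …, κr_{i,n}) for 1 ≤ i ≤ k. Then D is a free E-linear code of length n + 2 with dim_{F₂}(D_Res) = k + 1 and hull-rank l + 1. -/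
open scoped BigOperators

namespace BuildUp
open ECode RingE

def J (n : ℕ) : (Fin n → ZMod 2) →ₗ[ZMod 2] (Fin (n + 2) → ZMod 2) where
  toFun v := Fin.cons 0 (Fin.cons 0 v)
  map_add' v w := by
    funext i
    refine Fin.cases ?_ (fun i => ?_) i
    · simp
    · refine Fin.cases ?_ (fun i => ?_) i <;> simp
  map_smul' c w := by
    funext i
    refine Fin.cases ?_ (fun i => ?_) i
    · simp
    · refine Fin.cases ?_ (fun i => ?_) i <;> simp

def g {n : ℕ} (u : Fin n → ZMod 2) : Fin (n + 2) → ZMod 2 := Fin.cons 1 (Fin.cons 1 u)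

lemma J_zero {n : ℕ} (v : Fin n → ZMod 2) : J n v 0 = 0 := rfl

lemma J_succ {n : ℕ} (v : Fin n → ZMod 2) (i : Fin n) : J n v i.succ.succ = v i := rfl

lemma J_inj (n : ℕ) : Function.Injective (J n) := by
  intro v w h
  funext i
  have := congrFun h i.succ.succ
  simpa [J_succ] using this

def V {n : ℕ} (u : Fin n → ZMod 2) (S : Submodule (ZMod 2) (Fin n → ZMod 2)) :
    Submodule (ZMod 2) (Fin (n + 2) → ZMod 2) :=
  Submodule.span (ZMod 2) {g u} ⊔ S.map (J n)

lemma mem_V {n : ℕ} (u : Fin n → ZMod 2) (S : Submodule (ZMod 2) (Fin n → ZMod 2))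
    (x : Fin (n + 2) → ZMod 2) : x ∈ V u S ↔ ∃ c : ZMod 2, ∃ w ∈ S, x = c • g u + J n w := by
  simp only [V, Submodule.mem_sup, Submodule.mem_span_singleton, Submodule.mem_map]
  constructor
  · rintro ⟨_, ⟨c, rfl⟩, _, ⟨w, hw, rfl⟩, rfl⟩
    exact ⟨c, w, hw, rfl⟩
  · rintro ⟨c, w, hw, rfl⟩
    exact ⟨_, ⟨c, rfl⟩, _, ⟨w, hw, rfl⟩, rfl⟩

lemma finrank_V {n : ℕ} (u : Fin n → ZMod 2) (S : Submodule (ZMod 2) (Fin n → ZMod 2)) :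
    Module.finrank (ZMod 2) (V u S) = Module.finrank (ZMod 2) S + 1 := by
  have hg : g u ≠ 0 := fun h => by
    have := congrFun h 0
    simp [g] at this
  have hinf : Submodule.span (ZMod 2) {g u} ⊓ S.map (J n) = ⊥ := by
    rw [eq_bot_iff]
    rintro x ⟨h1, h2⟩
    obtain ⟨c, rfl⟩ := Submodule.mem_span_singleton.1 h1
    obtain ⟨w, hw, h⟩ := h2
    have := congrFun h 0
    simp only [J_zero, g, Pi.smul_apply, Fin.cons_zero, smul_eq_mul, mul_one] at this
    simp [← this]
  have h := Submodule.finrank_sup_add_finrank_inf_eq (Submodule.span (ZMod 2) {g u}) (S.map (J n))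
  rw [hinf, finrank_bot, finrank_span_singleton hg, LinearEquiv.finrank_eq (Submodule.equivMapOfInjective (J n) (J_inj n) S).symm] at h
  unfold V
  omega

def hull {n : ℕ} (W : Submodule (ZMod 2) (Fin n → ZMod 2)) :
    Submodule (ZMod 2) (Fin n → ZMod 2) where
  carrier := FHull (W : Set (Fin n → ZMod 2))
  add_mem' := by
    rintro a b ⟨ha, ha'⟩ ⟨hb, hb'⟩
    refine ⟨W.add_mem ha hb, fun w hw => ?_⟩
    have h1 := ha' w hw
    have h2 := hb' w hw
    simp only [Finner] at *
    simp [mul_add, Finset.sum_add_distrib, h1, h2]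
  zero_mem' := ⟨W.zero_mem, fun w hw => by simp [Finner]⟩
  smul_mem' := by
    rintro c a ⟨ha, ha'⟩
    refine ⟨W.smul_mem c ha, fun w hw => ?_⟩
    have h1 := ha' w hw
    simp only [Finner] at *
    simp only [Pi.smul_apply, smul_eq_mul, mul_left_comm _ c, ← Finset.mul_sum, h1, mul_zero]

lemma dimF_hull {n : ℕ} (W : Submodule (ZMod 2) (Fin n → ZMod 2)) :
    dimF (FHull (W : Set (Fin n → ZMod 2))) = Module.finrank (ZMod 2) (hull W) := by
  have : FHull (W : Set (Fin n → ZMod 2)) = (hull W : Set (Fin n → ZMod 2)) := rfl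
  unfold dimF
  rw [this, Submodule.span_eq]

lemma dimF_coe {n : ℕ} (W : Submodule (ZMod 2) (Fin n → ZMod 2)) :
    dimF (W : Set (Fin n → ZMod 2)) = Module.finrank (ZMod 2) W := by
  unfold dimF
  rw [Submodule.span_eq]

lemma two_zero (c : ZMod 2) : c + c = 0 := by revert c; decide

lemma Finner_comm {n : ℕ} (v w : Fin n → ZMod 2) : Finner v w = Finner w v := by
  simp [Finner, mul_comm]

lemma Finner_formula {n : ℕ} (u w w' : Fin n → ZMod 2) (c c' : ZMod 2)
    (hu : Finner u u = 0) (h : Finner u w = 0) (h' : Finner u w' = 0) :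
    Finner (c • g u + J n w) (c' • g u + J n w') = Finner w w' := by
  have e : Finner (c • g u + J n w) (c' • g u + J n w') =
      (c * c' + c * c') + c * c' * Finner u u + c * Finner u w' + c' * Finner u w
        + Finner w w' := by
    simp only [Finner, Fin.sum_univ_succ (n := n + 1), Fin.sum_univ_succ (n := n),
      Finset.mul_sum]
    simp only [J, g, LinearMap.coe_mk, AddHom.coe_mk, Pi.add_apply, Pi.smul_apply, Fin.cons_zero,
      Fin.cons_succ, smul_eq_mul, mul_one, add_zero, add_assoc, ← Finset.sum_add_distrib]
    congr 2
    refine Finset.sum_congr rfl fun i _ => ?_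
    ring
  rw [e, hu, h, h', two_zero]
  simp

lemma hull_V {n : ℕ} (u : Fin n → ZMod 2) (W : Submodule (ZMod 2) (Fin n → ZMod 2))
    (hu : Finner u u = 0) (h : ∀ w ∈ W, Finner u w = 0) : hull (V u W) = V u (hull W) := by
  ext x
  rw [mem_V]
  constructor
  · rintro ⟨hx, hx'⟩
    obtain ⟨c, w, hw, rfl⟩ := (mem_V _ _ _).1 hx
    refine ⟨c, w, ⟨hw, fun z hz => ?_⟩, rfl⟩
    have := hx' ((0 : ZMod 2) • g u + J n z) ((mem_V _ _ _).2 ⟨0, z, hz, rfl⟩)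
    rwa [Finner_formula u z w 0 c hu (h z hz) (h w hw)] at this
  · rintro ⟨c, w, ⟨hw, hw'⟩, rfl⟩
    refine ⟨(mem_V _ _ _).2 ⟨c, w, hw, rfl⟩, fun z hz => ?_⟩
    obtain ⟨c', w', hz', rfl⟩ := (mem_V _ _ _).1 hz
    rw [Finner_formula u w' w c' c hu (h w' hz') (h w hw)]
    exact hw' w' hz'

def sndVec {n : ℕ} (x : Fin n → RingE) : Fin n → ZMod 2 := fun i => Prod.snd (x i)

def Q {n : ℕ} (U : Submodule (ZMod 2) (Fin n → ZMod 2)) : AddSubmonoid (Fin n → RingE) where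
  carrier := {y | piVec y ∈ U ∧ sndVec y ∈ U}
  add_mem' := by
    rintro a b ⟨h1, h2⟩ ⟨h3, h4⟩
    exact ⟨U.add_mem h1 h3, U.add_mem h2 h4⟩
  zero_mem' := ⟨U.zero_mem, U.zero_mem⟩

lemma smul_kappa_mem {n : ℕ} (U : Submodule (ZMod 2) (Fin n → ZMod 2)) (a : RingE)
    (v : Fin n → ZMod 2) (hv : v ∈ U) : smulVec a (kappaVec v) ∈ Q U :=
  ⟨U.smul_mem (Prod.fst a) hv, U.smul_mem (Prod.snd a) hv⟩

lemma kappa_mem {n : ℕ} (U : Submodule (ZMod 2) (Fin n → ZMod 2))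
    (v : Fin n → ZMod 2) (hv : v ∈ U) : kappaVec v ∈ Q U :=
  ⟨hv, U.zero_mem⟩

lemma gen_g {n : ℕ} (u : Fin n → ZMod 2) :
    cons2 kappa kappa (kappaVec u) = kappaVec (g u) := by
  funext i
  refine Fin.cases rfl (fun i => ?_) i
  refine Fin.cases rfl (fun i => rfl) i

lemma gen_J {n : ℕ} (v : Fin n → ZMod 2) :
    cons2 0 0 (kappaVec v) = kappaVec (J n v) := by
  funext i
  refine Fin.cases rfl (fun i => ?_) i
  refine Fin.cases rfl (fun i => rfl) i

/-- Description of a code generated by vectors `κv`. -/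
lemma gen_eq {n : ℕ} (U : Submodule (ZMod 2) (Fin n → ZMod 2)) (X : Finset (Fin n → RingE))
    (T : Set (Fin n → ZMod 2)) (hT : Submodule.span (ZMod 2) T = U)
    (hX : ∀ x, x ∈ X ↔ ∃ v ∈ T, x = kappaVec v)
    (D : Set (Fin n → RingE)) (hD : IsECode D) (hgen : IsGenSet X D) :
    ∀ y, y ∈ D ↔ (piVec y ∈ U ∧ sndVec y ∈ U) := by
  obtain ⟨h0, hadd, hneg, hmul⟩ := hD
  have hTU : ∀ v ∈ T, v ∈ U := fun v hv => hT ▸ Submodule.subset_span hv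
  intro y
  constructor
  · intro hy
    change y ∈ Q U
    rw [← hgen] at hy
    rcases hy with ⟨c, rfl⟩ | ⟨S, hS, rfl⟩
    · refine AddSubmonoid.sum_mem _ fun x hx => ?_
      obtain ⟨v, hv, rfl⟩ := (hX x).1 hx
      exact smul_kappa_mem U _ v (hTU v hv)
    · refine AddSubmonoid.sum_mem _ fun x hx => ?_
      obtain ⟨v, hv, rfl⟩ := (hX x).1 (hS hx)
      exact kappa_mem U v (hTU v hv)
  · rintro ⟨h1, h2⟩
    have key : ∀ v ∈ U, ∀ a : RingE, smulVec a (kappaVec v) ∈ D := by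
      intro v hv
      rw [← hT] at hv
      induction hv using Submodule.span_induction with
      | mem v hv =>
        intro a
        refine hmul a _ ?_
        rw [← hgen]
        right
        exact ⟨{kappaVec v}, by simpa using (hX _).2 ⟨v, hv, rfl⟩, by simp⟩
      | zero =>
        intro a
        convert h0 using 1
        funext i
        exact mul_zero a
      | add v w _ _ hv hw =>
        intro a
        convert hadd _ (hv a) _ (hw a) using 1
        funext i
        exact mul_add a (kappaSMul (v i)) (kappaSMul (w i))
      | smul c v _ hv =>
        intro a
        have hc : c = 0 ∨ c = 1 := by revert c; decide
        rcases hc with rfl | rfl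
        · rw [zero_smul]
          convert h0 using 1
          funext i
          exact mul_zero a
        · rw [one_smul]
          exact hv a
    convert hadd _ (key _ h1 kappa) _ (key _ h2 zeta) using 1
    funext i
    have : y i = Prod.mk (1 * Prod.fst (y i) + 0 * Prod.snd (y i))
        (0 * Prod.fst (y i) + 1 * Prod.snd (y i)) := by
      rw [one_mul, one_mul, zero_mul, zero_mul, add_zero, zero_add]
      rfl
    exact this

end BuildUp

open ECode RingE in
/-- Build-up Construction II: from a free `[n, k]`-code `C` with hull-rank
`l` and a vector `u` with `⟨u,u⟩ = 0` and `⟨u, rᵢ⟩ = 0` for all `i`, the code `D`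
generated by `(κ, κ, κu)` together with the rows `(0, 0, κrᵢ)` is a free `[n+2, k+1]`-code
with hull-rank `l + 1`. -/
theorem buildup_construction_II {n k l : ℕ} (C : Set (Fin n → RingE)) (hC : IsECode C)
    (hfree : IsFree C) (r : Fin k → (Fin n → ZMod 2))
    (hli : LinearIndependent (ZMod 2) r)
    (hspan : (Submodule.span (ZMod 2) (Set.range r) : Set (Fin n → ZMod 2)) = Res C)
    (hl : dimF (FHull (Res C)) = l)
    (u : Fin n → ZMod 2) (hu : Finner u u = 0) (hur : ∀ i, Finner u (r i) = 0)
    (D : Set (Fin (n + 2) → RingE)) (hD : IsECode D)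
    (hgen : IsGenSet
      (insert (cons2 kappa kappa (kappaVec u))
        (Finset.image (fun i => cons2 0 0 (kappaVec (r i))) Finset.univ)) D) :
    IsFree D ∧ dimF (Res D) = k + 1 ∧ dimF (FHull (Res D)) = l + 1 := by
  obtain ⟨W, hW⟩ : ∃ W, W = Submodule.span (ZMod 2) (Set.range r) := ⟨_, rfl⟩
  rw [← hW] at hspan
  have huW : ∀ w ∈ W, Finner u w = 0 := by
    intro w hw
    rw [hW] at hw
    induction hw using Submodule.span_induction with
    | mem v hv =>
      obtain ⟨i, rfl⟩ := hv
      exact hur i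
    | zero => simp [Finner]
    | add v w _ _ hv hw =>
      simp only [Finner] at *
      simp [mul_add, Finset.sum_add_distrib, hv, hw]
    | smul c v _ hv =>
      simp only [Finner] at *
      simp only [Pi.smul_apply, smul_eq_mul, mul_left_comm _ c, ← Finset.mul_sum, hv, mul_zero]
  have hDiff := BuildUp.gen_eq (BuildUp.V u W) _ (insert (BuildUp.g u) (BuildUp.J n '' Set.range r))
    (by rw [Submodule.span_insert, ← Submodule.map_span, ← hW]; rfl)
    (by
      intro x
      simp only [BuildUp.gen_g, BuildUp.gen_J, Finset.mem_insert, Finset.mem_image,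
        Finset.mem_univ, true_and]
      constructor
      · rintro (rfl | ⟨i, rfl⟩)
        · exact ⟨_, Or.inl rfl, rfl⟩
        · exact ⟨_, Or.inr ⟨_, ⟨i, rfl⟩, rfl⟩, rfl⟩
      · rintro ⟨_, rfl | ⟨_, ⟨i, rfl⟩, rfl⟩, rfl⟩
        · exact Or.inl rfl
        · exact Or.inr ⟨i, rfl⟩) D hD hgen
  have hRes : Res D = (BuildUp.V u W : Set _) := by
    ext v
    constructor
    · rintro ⟨y, hy, rfl⟩
      exact ((hDiff y).1 hy).1
    · intro hv
      exact ⟨kappaVec v, (hDiff _).2 ⟨hv, (BuildUp.V u W).zero_mem⟩, rfl⟩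
  have hTor : Tor D = (BuildUp.V u W : Set _) := by
    ext v
    constructor
    · intro hy
      exact ((hDiff _).1 hy).2
    · intro hv
      exact (hDiff _).2 ⟨(BuildUp.V u W).zero_mem, hv⟩
  refine ⟨hRes.trans hTor.symm, ?_, ?_⟩
  · rw [hRes, BuildUp.dimF_coe, BuildUp.finrank_V, hW, finrank_span_eq_card hli, Fintype.card_fin]
  · rw [hRes]
    rw [BuildUp.dimF_hull, BuildUp.hull_V u W hu huW, BuildUp.finrank_V, ← hl, ← hspan,
      BuildUp.dimF_hull]
end
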